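/- Let p and n be integers with p ≤ n ≤ 2p−5, set φ := n − p, and for 1 ≤ x ≤ n−1 let D_x := G_x⁻¹ · G_{n−1} in H_n. If x ≥ max(2, 2φ+1), or x is odd with x ≥ 3, then D_x lies in the subgroup U_{x+1}; if x = 1, or x is even with x ≤ 2φ, then D_x lies in the subgroup U_x. -/

import Mathlib

/-- Right-angled Artin relations on `N` generators (indexed `0, …, N-1`, standing for
`h_1, …, h_N`): commutators of generators whose indices differ by more than one. -/
def RaagRels (N : ℕ) : Set (FreeGroup (Fin N)) :=
  {rel | ∃ i j : Fin N, (i : ℕ) + 1 < (j : ℕ) ∧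
    rel = FreeGroup.of i * FreeGroup.of j * (FreeGroup.of i)⁻¹ * (FreeGroup.of j)⁻¹}

/-- The right-angled Artin group `H_n` on generators `h_1, …, h_{n-1}` subject to
`h_i h_j = h_j h_i` whenever `|i - j| > 1`. -/
abbrev Hgrp (n : ℕ) := PresentedGroup (RaagRels (n - 1))

/-- The generator `h_i` of `H_n`, for `1 ≤ i ≤ n-1` (and `1` for out-of-range indices). -/
def hgen (n : ℕ) (i : ℕ) : Hgrp n :=
  if h : 1 ≤ i ∧ i ≤ n - 1 then PresentedGroup.of (⟨i - 1, by omega⟩ : Fin (n - 1)) else 1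

/-- `A(a,b) := h_a h_{a+1} ⋯ h_b` (the identity when `a > b`). -/
def Aprod (n a b : ℕ) : Hgrp n := ((List.range' a (b + 1 - a) 1).map (hgen n)).prod

/-- `E(a,b) := h_a h_{a+2} ⋯ h_b` for even `a, b` (the identity when `a > b`). -/
def Eprod (n a b : ℕ) : Hgrp n := ((List.range' a ((b + 2 - a) / 2) 2).map (hgen n)).prod

/-- `O(a,b) := h_a h_{a+2} ⋯ h_b` for odd `a, b` (the identity when `a > b`). -/
def Oprod (n a b : ℕ) : Hgrp n := ((List.range' a ((b + 2 - a) / 2) 2).map (hgen n)).prod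

/-- The elements `G_i` of `H_n` (with `φ := n - p`): `G_1 := h_1`,
`G_{2k} := O(3,2k-1)·E(2,2k)` and `G_{2k+1} := O(3,2k+1)·E(2,2k)` for `1 ≤ k ≤ φ`, and
`G_i := O(3,2φ+1)·E(2,2φ)·A(2φ+2,i)` for `2φ+2 ≤ i ≤ n-1`. -/
def Ggen (n p i : ℕ) : Hgrp n :=
  if i = 1 then hgen n 1
  else if i ≤ 2 * (n - p) + 1 then
    if i % 2 = 0 then Oprod n 3 (i - 1) * Eprod n 2 i
    else Oprod n 3 i * Eprod n 2 (i - 1)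
  else Oprod n 3 (2 * (n - p) + 1) * Eprod n 2 (2 * (n - p)) * Aprod n (2 * (n - p) + 2) i

/-- `L_m`: the subgroup of `H_n` generated by the `h_i` with `1 ≤ i ≤ min m (n-1)`. -/
def Lsub (n m : ℕ) : Subgroup (Hgrp n) :=
  Subgroup.closure {x | ∃ i : ℕ, 1 ≤ i ∧ i ≤ min m (n - 1) ∧ x = hgen n i}

/-- `U_m`: the subgroup of `H_n` generated by the `h_i` with `max m 1 ≤ i ≤ n-1`. -/
def Usub (n m : ℕ) : Subgroup (Hgrp n) :=
  Subgroup.closure {x | ∃ i : ℕ, max m 1 ≤ i ∧ i ≤ n - 1 ∧ x = hgen n i}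

theorem hgen_mem (n m i : ℕ) (h : m ≤ i) : hgen n i ∈ Usub n m := by
  by_cases hi : 1 ≤ i ∧ i ≤ n - 1
  · exact Subgroup.subset_closure ⟨i, by simp [h, hi.1], hi.2, rfl⟩
  · rw [hgen, dif_neg hi]; exact one_mem _

theorem hgen_comm (n i j : ℕ) (h : i + 1 < j) : Commute (hgen n i) (hgen n j) := by
  by_cases hi : 1 ≤ i ∧ i ≤ n - 1
  · by_cases hj : 1 ≤ j ∧ j ≤ n - 1
    · rw [hgen, hgen, dif_pos hi, dif_pos hj]
      have hr : FreeGroup.of (⟨i - 1, by omega⟩ : Fin (n - 1)) *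
          FreeGroup.of (⟨j - 1, by omega⟩ : Fin (n - 1)) *
          (FreeGroup.of (⟨i - 1, by omega⟩ : Fin (n - 1)))⁻¹ *
          (FreeGroup.of (⟨j - 1, by omega⟩ : Fin (n - 1)))⁻¹ ∈ RaagRels (n - 1) :=
        ⟨_, _, by simp only; omega, rfl⟩
      have h1 := PresentedGroup.one_of_mem hr
      simp only [map_mul, map_inv] at h1
      exact mul_inv_eq_iff_eq_mul.mp (mul_inv_eq_one.mp h1)
    · have h1 : hgen n j = 1 := by rw [hgen, dif_neg hj]
      rw [h1]; exact Commute.one_right _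
  · have h1 : hgen n i = 1 := by rw [hgen, dif_neg hi]
    rw [h1]; exact Commute.one_left _

/-- product of `k` generators starting at `a` with step `s` -/
def stepProd (n a k s : ℕ) : Hgrp n := ((List.range' a k s).map (hgen n)).prod

theorem stepProd_mem (n m a k s : ℕ) (h : m ≤ a) : stepProd n a k s ∈ Usub n m := by
  apply Subgroup.list_prod_mem
  intro x hx
  obtain ⟨i, hi, rfl⟩ := List.mem_map.mp hx
  obtain ⟨t, _, rfl⟩ := List.mem_range'.mp hi
  exact hgen_mem _ _ _ (by nlinarith [Nat.zero_le (s * t)])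

theorem stepProd_append (n a k l s : ℕ) :
    stepProd n a (k + l) s = stepProd n a k s * stepProd n (a + s * k) l s := by
  simp only [stepProd]
  rw [← List.prod_append, ← List.map_append, List.range'_append]

theorem stepProd_comm (n a k b l s : ℕ) (h : a + s * k + 1 < b + s) :
    Commute (stepProd n a k s) (stepProd n b l s) := by
  apply Commute.list_prod_left
  intro x hx
  apply Commute.list_prod_right
  intro y hy
  obtain ⟨i, hi, rfl⟩ := List.mem_map.mp hx
  obtain ⟨j, hj, rfl⟩ := List.mem_map.mp hy
  obtain ⟨t, ht, rfl⟩ := List.mem_range'.mp hi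
  obtain ⟨u, _, rfl⟩ := List.mem_range'.mp hj
  apply hgen_comm
  have : s * (t + 1) ≤ s * k := Nat.mul_le_mul_left s ht
  nlinarith [Nat.zero_le (s * u)]

theorem Aprod_eq (n a b k : ℕ) (h : b + 1 - a = k) : Aprod n a b = stepProd n a k 1 := by
  subst h; rfl

theorem Eprod_eq (n a b k : ℕ) (h : (b + 2 - a) / 2 = k) : Eprod n a b = stepProd n a k 2 := by
  subst h; rfl

theorem Oprod_eq (n a b k : ℕ) (h : (b + 2 - a) / 2 = k) : Oprod n a b = stepProd n a k 2 := by
  subst h; rfl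

theorem Ggen_big (n p i f l : ℕ) (hf : n - p = f) (h : i = 2 * f + 1 + l) (hi : i ≠ 1) :
    Ggen n p i = stepProd n 3 f 2 * stepProd n 2 f 2 * stepProd n (2 * f + 2) l 1 := by
  subst hf
  rw [Ggen, if_neg hi]
  split_ifs with h1 h2
  · omega
  · obtain rfl : l = 0 := by omega
    rw [Oprod_eq n 3 i (n - p) (by omega), Eprod_eq n 2 (i - 1) (n - p) (by omega)]
    simp [stepProd]
  · rw [Oprod_eq n 3 _ (n - p) (by omega), Eprod_eq n 2 _ (n - p) (by omega),
      Aprod_eq n _ _ l (by omega)]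

theorem D_big (n p x f : ℕ) (hf : n - p = f) (h0 : x ≠ 1) (h1 : 2 * f + 1 ≤ x) (h2 : x ≤ n - 1) :
    (Ggen n p x)⁻¹ * Ggen n p (n - 1) ∈ Usub n (x + 1) := by
  obtain ⟨l, rfl⟩ := Nat.exists_eq_add_of_le h1
  obtain ⟨m, hm⟩ := Nat.exists_eq_add_of_le h2
  rw [Ggen_big n p _ f l hf rfl h0, Ggen_big n p (n - 1) f (l + m) hf (by omega) (by omega),
    stepProd_append, ← mul_assoc _ (stepProd n (2 * f + 2) l 1), inv_mul_cancel_left]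
  exact stepProd_mem _ _ _ _ _ (by omega)

theorem D_odd (n p k j f : ℕ) (hf : n - p = f) (hk : 1 ≤ k) (h1 : f = k + j)
    (h2 : 2 * f + 1 ≤ n - 1) :
    (Ggen n p (2 * k + 1))⁻¹ * Ggen n p (n - 1) ∈ Usub n (2 * k + 1 + 1) := by
  obtain ⟨m, hm⟩ := Nat.exists_eq_add_of_le h2
  have hG : Ggen n p (2 * k + 1) = stepProd n 3 k 2 * stepProd n 2 k 2 := by
    rw [Ggen, if_neg (by omega), if_pos (by omega), if_neg (by omega),
      Oprod_eq n 3 _ k (by omega), Eprod_eq n 2 _ k (by omega)]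
  rw [hG, Ggen_big n p (n - 1) f m hf hm (by omega), h1, stepProd_append n 3,
    stepProd_append n 2]
  have hc := stepProd_comm n 2 k (3 + 2 * k) j 2 (by omega)
  have key : ∀ a b c d e : Hgrp n, Commute c b →
      (a * c)⁻¹ * (a * b * (c * d) * e) = b * d * e := by
    intro a b c d e h
    have : a * b * (c * d) * e = (a * c) * (b * d * e) := by
      simp only [mul_assoc]; rw [← mul_assoc b c, ← h.eq]; simp only [mul_assoc]
    rw [this, inv_mul_cancel_left]
  rw [key _ _ _ _ _ hc]
  exact mul_mem (mul_mem (stepProd_mem _ _ _ _ _ (by omega)) (stepProd_mem _ _ _ _ _ (by omega)))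
    (stepProd_mem _ _ _ _ _ (by omega))

theorem D_even (n p k j f : ℕ) (hf : n - p = f) (h1 : f = k + j) (hj : 1 ≤ j)
    (h2 : 2 * f + 1 ≤ n - 1) :
    (Ggen n p (2 * (k + 1)))⁻¹ * Ggen n p (n - 1) ∈ Usub n (2 * (k + 1)) := by
  obtain ⟨m, hm⟩ := Nat.exists_eq_add_of_le h2
  have hG : Ggen n p (2 * (k + 1)) = stepProd n 3 k 2 * stepProd n 2 (k + 1) 2 := by
    rw [Ggen, if_neg (by omega), if_pos (by omega), if_pos (by omega),
      Oprod_eq n 3 _ k (by omega), Eprod_eq n 2 _ (k + 1) (by omega)]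
  rw [hG, Ggen_big n p (n - 1) f m hf hm (by omega), h1, stepProd_append n 3,
    stepProd_append n 2 k j, stepProd_append n 2 k 1]
  have hc := stepProd_comm n 2 k (3 + 2 * k) j 2 (by omega)
  have key : ∀ a b c d e g : Hgrp n, Commute c b →
      (a * (c * g))⁻¹ * (a * b * (c * d) * e) = g⁻¹ * (b * d * e) := by
    intro a b c d e g h
    have : a * b * (c * d) * e = (a * (c * g)) * (g⁻¹ * (b * d * e)) := by
      simp only [mul_assoc, mul_inv_cancel_left]
      rw [← mul_assoc b c, ← h.eq]; simp only [mul_assoc]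
    rw [this, inv_mul_cancel_left]
  rw [key _ _ _ _ _ _ hc]
  exact mul_mem (inv_mem (stepProd_mem _ _ _ _ _ (by omega)))
    (mul_mem (mul_mem (stepProd_mem _ _ _ _ _ (by omega)) (stepProd_mem _ _ _ _ _ (by omega)))
    (stepProd_mem _ _ _ _ _ (by omega)))

/-- Lemma 6.7, item 1 (generic form):  for `p ≤ n ≤ 2p - 5` and `1 ≤ x ≤ n-1`, the
element `D_x := G_x⁻¹ G_{n-1}` of `H_n` lies in the subgroup `U_{x+1}` if
`x ≥ max 2 (2φ+1)` or `x` is odd with `x ≥ 3`, and lies in `U_x` if `x = 1` or `x` is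
even with `x ≤ 2φ`. -/
theorem stmt_16 (p n : ℕ) (hpn : p ≤ n) (hn : n ≤ 2 * p - 5)
    (x : ℕ) (hx1 : 1 ≤ x) (hx2 : x ≤ n - 1) :
    (max 2 (2 * (n - p) + 1) ≤ x ∨ (Odd x ∧ 3 ≤ x) →
      (Ggen n p x)⁻¹ * Ggen n p (n - 1) ∈ Usub n (x + 1)) ∧
    (x = 1 ∨ (Even x ∧ x ≤ 2 * (n - p)) →
      (Ggen n p x)⁻¹ * Ggen n p (n - 1) ∈ Usub n x) := by
  have h2 : 2 * (n - p) + 1 ≤ n - 1 := by omega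
  refine ⟨fun h => ?_, fun h => ?_⟩
  · by_cases hb : 2 * (n - p) + 1 ≤ x
    · exact D_big n p x _ rfl (by omega) hb hx2
    · obtain ⟨⟨k, rfl⟩, h3⟩ : Odd x ∧ 3 ≤ x := by
        rcases h with h | h
        · omega
        · exact h
      exact D_odd n p k (n - p - k) _ rfl (by omega) (by omega) h2
  · rcases h with rfl | ⟨⟨k, hk⟩, h3⟩
    · rw [Ggen_big n p (n - 1) _ (n - 1 - (2 * (n - p) + 1)) rfl (by omega) (by omega),
        Ggen, if_pos rfl]
      exact mul_mem (inv_mem (hgen_mem _ _ _ le_rfl))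
        (mul_mem (mul_mem (stepProd_mem _ _ _ _ _ (by omega))
          (stepProd_mem _ _ _ _ _ (by omega))) (stepProd_mem _ _ _ _ _ (by omega)))
    · obtain ⟨k, rfl⟩ : ∃ k', x = 2 * (k' + 1) := ⟨k - 1, by omega⟩
      exact D_even n p k (n - p - k) _ rfl (by omega) (by omega) h2
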